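/- arXiv:math/0703483 — 2 statements merged into one kernel-verified Lean document; each statement's English description precedes it below -/
import Mathlib

section
/- Let K be an algebraically closed field, R = K[u_1,…,u_m, x_1,…,x_n], and let H be an ideal of R with H ∩ K[u] = (0) and with Krull dimension of R/H equal to m, and let T ∈ R. Then T does not vanish identically on any irreducible component of V(H) where the u-variables remain independent (i.e., T ∉ p for every minimal prime p over H with p ∩ K[u] = (0)) if and only if (H + (T)) ∩ K[u] ≠ (0). -/
open MvPolynomial

/-- Krull dimension does not drop along an injective integral extension. -/
theorem ringKrullDim_le_of_isIntegral_of_faithfulSMul (A B : Type*) [CommRing A] [CommRing B]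
    [Algebra A B] [Algebra.IsIntegral A B] [FaithfulSMul A B] :
    ringKrullDim A ≤ ringKrullDim B := by
  refine iSup_le fun l ↦ ?_
  obtain ⟨P, hP, hPl⟩ := (Ideal.nonempty_primesOver (S := B) l.head.asIdeal).some
  obtain ⟨L, hL, -⟩ := Ideal.exists_ltSeries_of_hasGoingUp l P
  rw [← hL]
  exact Order.LTSeries.length_le_krullDim L

/-- An algebraically independent family in an affine domain has at most `dim A` elements. -/
theorem AlgebraicIndependent.natCast_le_ringKrullDim {K A : Type*} [Field K] [CommRing A]
    [IsDomain A] [Algebra K A] [Algebra.FiniteType K A] {m : ℕ} {x : Fin m → A}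
    (hx : AlgebraicIndependent K x) : (m : WithBot ℕ∞) ≤ ringKrullDim A := by
  obtain ⟨s, g, hg, hint⟩ := exists_integral_inj_algHom_of_fg K A
  algebraize [g.toRingHom]
  have : FaithfulSMul (MvPolynomial (Fin s) K) A :=
    (faithfulSMul_iff_algebraMap_injective _ _).mpr hg
  have htr : Algebra.trdeg K A = s := by
    have h := lift_trdeg_add_eq K (MvPolynomial (Fin s) K) A
    have h0 : Algebra.trdeg (MvPolynomial (Fin s) K) A = 0 :=
      have : Algebra.IsAlgebraic (MvPolynomial (Fin s) K) A := Algebra.IsIntegral.isAlgebraic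
      trdeg_eq_zero
    simpa [h0, eq_comm] using h
  have hms : m ≤ s := by
    have h := hx.lift_cardinalMk_le_trdeg
    rw [htr] at h
    simpa using h
  calc (m : WithBot ℕ∞) ≤ s := by exact_mod_cast hms
    _ = ringKrullDim (MvPolynomial (Fin s) K) := by simp
    _ ≤ ringKrullDim A := ringKrullDim_le_of_isIntegral_of_faithfulSMul _ _

/-- With u independent for H and dim R/H = m: T does not vanish identically on any
irreducible component of V(H) where the u-variables remain independent iff
(H + (T)) ∩ K[u] ≠ 0. -/
theorem stmt_6 {K : Type*} [Field K] [IsAlgClosed K] {m n : ℕ}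
    (H : Ideal (MvPolynomial (Fin m ⊕ Fin n) K))
    (T : MvPolynomial (Fin m ⊕ Fin n) K)
    (hind : H.comap (MvPolynomial.rename (Sum.inl : Fin m → Fin m ⊕ Fin n)).toRingHom = ⊥)
    (hdim : ringKrullDim (MvPolynomial (Fin m ⊕ Fin n) K ⧸ H) = (m : ℕ)) :
    (∀ p ∈ H.minimalPrimes,
        p.comap (MvPolynomial.rename (Sum.inl : Fin m → Fin m ⊕ Fin n)).toRingHom = ⊥ →
          T ∉ p) ↔
      (H + Ideal.span {T}).comap
        (MvPolynomial.rename (Sum.inl : Fin m → Fin m ⊕ Fin n)).toRingHom ≠ ⊥ := by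
  constructor
  · intro h hbot
    obtain ⟨q, hle, hq, hqle⟩ := Ideal.exists_ideal_comap_le_prime ⊥ _ hbot.le
    have hqbot := le_bot_iff.mp hqle
    have hHq : H ≤ q := le_sup_left.trans hle
    have hTq : T ∈ q := hle (Ideal.mem_sup_right (Ideal.mem_span_singleton_self T))
    obtain ⟨p, hp, hpq⟩ := Ideal.exists_minimalPrimes_le hHq
    have hTp : T ∉ p := h p hp (le_bot_iff.mp ((Ideal.comap_mono hpq).trans hqbot.le))
    have : p.IsPrime := hp.1.1
    have hlow : (m : WithBot ℕ∞) ≤ ringKrullDim (MvPolynomial (Fin m ⊕ Fin n) K ⧸ q) := by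
      refine AlgebraicIndependent.natCast_le_ringKrullDim (K := K)
        (x := fun i ↦ Ideal.Quotient.mkₐ K q (X (Sum.inl i))) ?_
      rw [algebraicIndependent_iff]
      intro f hf
      rw [← Ideal.mem_bot, ← hqbot]
      refine (Ideal.Quotient.eq_zero_iff_mem (I := q)).mp ?_
      change Ideal.Quotient.mkₐ K q (rename Sum.inl f) = 0
      rw [← hf, rename_eq_aeval, comp_aeval_apply]
      rfl
    have hstep : ringKrullDim (MvPolynomial (Fin m ⊕ Fin n) K ⧸ q) + 1 ≤
        ringKrullDim (MvPolynomial (Fin m ⊕ Fin n) K ⧸ p) :=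
      ringKrullDim_succ_le_of_surjective (Ideal.Quotient.factor hpq)
        (Ideal.Quotient.factor_surjective hpq) (r := Ideal.Quotient.mk p T)
        (mem_nonZeroDivisors_of_ne_zero (mt Ideal.Quotient.eq_zero_iff_mem.mp hTp))
        (Ideal.Quotient.eq_zero_iff_mem.mpr hTq)
    have hup : ringKrullDim (MvPolynomial (Fin m ⊕ Fin n) K ⧸ p) ≤ (m : ℕ) :=
      hdim ▸ ringKrullDim_le_of_surjective (Ideal.Quotient.factor hp.1.2)
        (Ideal.Quotient.factor_surjective hp.1.2)
    have hcontra : ((m + 1 : ℕ) : WithBot ℕ∞) ≤ (m : ℕ) := by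
      push_cast
      exact ((add_le_add_left hlow 1).trans hstep).trans hup
    exact absurd (by exact_mod_cast hcontra) (Nat.not_succ_le_self m)
  · intro h p hp hpbot hTp
    exact h (le_bot_iff.mp ((Ideal.comap_mono (sup_le hp.1.2
      ((Ideal.span_singleton_le_iff_mem p).mpr hTp))).trans hpbot.le))
end

section
/- Let K be an algebraically closed field, R = K[u_1,…,u_m, x_1,…,x_n], and let H be an ideal of R with H ∩ K[u] = (0) and with Krull dimension of R/H equal to m, and let T ∈ R. Then the following are equivalent: (i) there exist minimal primes p and q over H with p ∩ K[u] = (0), q ∩ K[u] = (0), T ∈ p and T ∉ q (i.e., T vanishes identically on some irreducible component of V(H) where u remains independent and fails to vanish identically on some other such component); (ii) both contractions (H·R[z] + (T·z − 1)·R[z]) ∩ K[u] and (H + (T)) ∩ K[u] are the zero ideal. -/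
open MvPolynomial

universe v

theorem Ideal.exists_isPrime_le_comap_eq_bot {A B : Type*} [CommRing A] [IsDomain A] [CommRing B]
    (f : A →+* B) {J : Ideal B} (h : J.comap f = ⊥) :
    ∃ P : Ideal B, P.IsPrime ∧ J ≤ P ∧ P.comap f = ⊥ := by
  obtain ⟨P, hJP, hP, hle⟩ := Ideal.exists_ideal_comap_le_prime (f := f) ⊥ J h.le
  exact ⟨P, hP, hJP, le_bot_iff.mp hle⟩

theorem ringKrullDim_le_of_isIntegral_of_injective {A B : Type*} [CommRing A] [CommRing B]
    [Algebra A B] [Algebra.IsIntegral A B] (h : Function.Injective (algebraMap A B)) :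
    ringKrullDim A ≤ ringKrullDim B := by
  have : FaithfulSMul A B := (faithfulSMul_iff_algebraMap_injective A B).mpr h
  refine iSup_le fun l ↦ ?_
  obtain ⟨P, hP, hPl⟩ : ∃ P : Ideal B, P.IsPrime ∧ P.LiesOver l.head.asIdeal := by
    obtain ⟨Q, -, hQ, hQ'⟩ := Ideal.exists_ideal_over_prime_of_isIntegral l.head.asIdeal
      (⊥ : Ideal B) (by simp [Ideal.comap_bot_of_injective _ h])
    exact ⟨Q, hQ, ⟨hQ'.symm⟩⟩
  obtain ⟨L, hL, -⟩ := Ideal.exists_ltSeries_of_hasGoingUp l P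
  rw [← hL]
  exact le_iSup (fun L : LTSeries (PrimeSpectrum B) ↦ (L.length : WithBot ℕ∞)) L

theorem MvPolynomial.le_ringKrullDim_of_injective {K A : Type v} [Field K] [CommRing A] [IsDomain A]
    [Algebra K A] [Algebra.FiniteType K A] {m : ℕ} (f : MvPolynomial (Fin m) K →ₐ[K] A)
    (hf : Function.Injective f) : (m : WithBot ℕ∞) ≤ ringKrullDim A := by
  obtain ⟨s, g, hg, hint⟩ := exists_integral_inj_algHom_of_fg K A
  algebraize [g.toRingHom]
  have : FaithfulSMul (MvPolynomial (Fin s) K) A :=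
    (faithfulSMul_iff_algebraMap_injective _ _).mpr hg
  have : IsScalarTower K (MvPolynomial (Fin s) K) A :=
    .of_algebraMap_eq fun x ↦ (g.commutes x).symm
  have : Algebra.IsIntegral (MvPolynomial (Fin s) K) A := ⟨hint⟩
  have hms : m ≤ s := by
    have h := trdeg_le_of_injective f hf
    rw [← trdeg_add_eq K (MvPolynomial (Fin s) K) (A := A),
      trdeg_eq_zero (R := MvPolynomial (Fin s) K)] at h
    simpa [MvPolynomial.trdeg_of_isDomain] using h
  have h := ringKrullDim_le_of_isIntegral_of_injective (A := MvPolynomial (Fin s) K) (B := A) hg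
  rw [MvPolynomial.ringKrullDim_of_isNoetherianRing, ringKrullDim_eq_zero_of_field] at h
  refine le_trans ?_ h
  simpa using hms

theorem Ideal.eq_of_le_of_ringKrullDim_quotient_le {R : Type*} [CommRing R] {p P : Ideal R}
    [p.IsPrime] (h : p ≤ P) {d : ℕ} (hp : ringKrullDim (R ⧸ p) ≤ d)
    (hP : d ≤ ringKrullDim (R ⧸ P)) : p = P := by
  by_contra hne
  obtain ⟨r, hrP, hrp⟩ :=
    Set.exists_of_ssubset (lt_of_le_of_ne h (mt SetLike.coe_injective.eq_iff.mp hne))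
  have hlt := ringKrullDim_succ_le_of_surjective (Ideal.Quotient.factor h)
    (Ideal.Quotient.factor_surjective h) (r := Ideal.Quotient.mk p r)
    (mem_nonZeroDivisors_of_ne_zero (by simpa [Ideal.Quotient.eq_zero_iff_mem] using hrp))
    (by simpa [Ideal.Quotient.eq_zero_iff_mem] using hrP)
  have : ((d : ℕ) : WithBot ℕ∞) + 1 ≤ d := by
    refine le_trans ?_ (hlt.trans hp)
    gcongr
  norm_cast at this
  lia

theorem Ideal.mem_of_C_mem_map_sup_span_C_mul_X_sub_one {R : Type*} [CommRing R] {H q : Ideal R}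
    [q.IsPrime] (hq : H ≤ q) {T f : R} (hT : T ∉ q)
    (hf : Polynomial.C f ∈ H.map Polynomial.C + Ideal.span {Polynomial.C T * Polynomial.X - 1}) :
    f ∈ q := by
  let φ : R →+* FractionRing (R ⧸ q) := (algebraMap (R ⧸ q) _).comp (Ideal.Quotient.mk q)
  have hφ (r : R) : φ r = 0 ↔ r ∈ q := by
    simp [φ, Ideal.Quotient.eq_zero_iff_mem]
  have hle : H.map Polynomial.C + Ideal.span {Polynomial.C T * Polynomial.X - 1} ≤
      RingHom.ker (Polynomial.eval₂RingHom φ (φ T)⁻¹) := by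
    refine sup_le (Ideal.map_le_iff_le_comap.mpr fun r hr ↦ ?_) ?_
    · simpa [RingHom.mem_ker] using (hφ r).mpr (hq hr)
    · rw [Ideal.span_singleton_le_iff_mem, RingHom.mem_ker]
      simp [mul_inv_cancel₀ (mt (hφ T).mp hT)]
  simpa [RingHom.mem_ker, hφ] using hle hf

/-- With u independent for H and dim R/H = m: T vanishes identically on some u-independent
irreducible component of V(H) and fails to vanish identically on some other such
component iff both contractions (H·R[z] + (T·z − 1)) ∩ K[u] and (H + (T)) ∩ K[u]
are the zero ideal. -/
theorem stmt_7 {K : Type*} [Field K] [IsAlgClosed K] {m n : ℕ}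
    (H : Ideal (MvPolynomial (Fin m ⊕ Fin n) K))
    (T : MvPolynomial (Fin m ⊕ Fin n) K)
    (hind : H.comap (MvPolynomial.rename (Sum.inl : Fin m → Fin m ⊕ Fin n)).toRingHom = ⊥)
    (hdim : ringKrullDim (MvPolynomial (Fin m ⊕ Fin n) K ⧸ H) = (m : ℕ)) :
    (∃ p ∈ H.minimalPrimes, ∃ q ∈ H.minimalPrimes,
        p.comap (MvPolynomial.rename (Sum.inl : Fin m → Fin m ⊕ Fin n)).toRingHom = ⊥ ∧
        q.comap (MvPolynomial.rename (Sum.inl : Fin m → Fin m ⊕ Fin n)).toRingHom = ⊥ ∧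
        T ∈ p ∧ T ∉ q) ↔
      ((H.map (Polynomial.C :
              MvPolynomial (Fin m ⊕ Fin n) K →+* Polynomial (MvPolynomial (Fin m ⊕ Fin n) K)) +
            Ideal.span {Polynomial.C T * Polynomial.X - 1}).comap
          ((Polynomial.C :
              MvPolynomial (Fin m ⊕ Fin n) K →+* Polynomial (MvPolynomial (Fin m ⊕ Fin n) K)).comp
            (MvPolynomial.rename (Sum.inl : Fin m → Fin m ⊕ Fin n)).toRingHom) = ⊥ ∧
        (H + Ideal.span {T}).comap
          (MvPolynomial.rename (Sum.inl : Fin m → Fin m ⊕ Fin n)).toRingHom = ⊥) := by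
  constructor
  · rintro ⟨p, hp, q, hq, hpu, hqu, hTp, hTq⟩
    have := hq.isPrime
    refine ⟨eq_bot_iff.mpr fun f hf ↦ ?_, eq_bot_iff.mpr ?_⟩
    · rw [← hqu]
      exact Ideal.mem_of_C_mem_map_sup_span_C_mul_X_sub_one hq.le hTq hf
    · rw [← hpu]
      exact Ideal.comap_mono (sup_le hp.le ((Ideal.span_singleton_le_iff_mem _).mpr hTp))
  · rintro ⟨h₁, h₂⟩
    obtain ⟨P, hP, hHP, hPu⟩ := Ideal.exists_isPrime_le_comap_eq_bot _ h₂
    obtain ⟨Q, hQ, hHQ, hQu⟩ := Ideal.exists_isPrime_le_comap_eq_bot _ h₁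
    obtain ⟨p, hp, hpP⟩ := Ideal.exists_minimalPrimes_le (le_sup_left.trans hHP)
    obtain ⟨q, hq, hqQ⟩ := Ideal.exists_minimalPrimes_le
      (Ideal.map_le_iff_le_comap.mp (le_sup_left.trans hHQ))
    have := hp.isPrime
    have hTP : T ∈ P := hHP (Ideal.mem_sup_right (Ideal.mem_span_singleton_self T))
    have hpP : p = P := by
      refine Ideal.eq_of_le_of_ringKrullDim_quotient_le hpP (d := m) ?_ ?_
      · rw [← hdim]
        exact ringKrullDim_le_of_surjective (Ideal.Quotient.factor hp.le)
          (Ideal.Quotient.factor_surjective hp.le)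
      · refine MvPolynomial.le_ringKrullDim_of_injective
          ((Ideal.Quotient.mkₐ K P).comp (MvPolynomial.rename Sum.inl)) ?_
        refine (injective_iff_map_eq_zero _).mpr fun f hf ↦ ?_
        rw [← Ideal.mem_bot, ← hPu]
        exact (Ideal.Quotient.eq_zero_iff_mem (I := P)).mp hf
    refine ⟨p, hp, q, hq, hpP ▸ hPu, ?_, hpP ▸ hTP, fun hTq ↦ hQ.ne_top ?_⟩
    · rw [← Ideal.comap_comap] at hQu
      exact eq_bot_iff.mpr (hQu ▸ Ideal.comap_mono hqQ)
    · have hT : Polynomial.C T ∈ Q := hqQ hTq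
      have h : Polynomial.C T * Polynomial.X - 1 ∈ Q :=
        hHQ (Ideal.mem_sup_right (Ideal.mem_span_singleton_self _))
      exact (Ideal.eq_top_iff_one _).mpr
        (by simpa using sub_mem (Q.mul_mem_right Polynomial.X hT) h)
end
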